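/- Let n ≥ 1, d ≥ 1, and let Û_{i,j} ∈ [0,1] for i = 1,…,n and j = 1,…,d. For the symmetric tail weight function w_t(u) = ∏_{j=1}^d (u_j − 1/2)², the tail-weighted statistic T_n = n ∫_{[0,1]^d} (C_n(u) − ∏_{j=1}^d u_j)² ∏_{j=1}^d (u_j − 1/2)² du satisfies T_n = Σ_{i=1}^n [ (1/n) Σ_{l=1}^n ∏_{j=1}^d ( 1/24 − (1/3)(Û_{i,j}∨Û_{l,j} − 1/2)³ ) − 2 ∏_{j=1}^d ( 1/24 − (1/4)Û_{i,j}⁴ + (1/3)Û_{i,j}³ − (1/8)Û_{i,j}² ) ] + n·30^{-d}. -/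

import Mathlib

open MeasureTheory Finset

/-- Lebesgue measure on the unit cube is the product of the Lebesgue measures on `[0, 1]`. -/
lemma volume_restrict_Icc_pi_eq_pi {ι : Type*} [Fintype ι] :
    (volume : Measure (ι → ℝ)).restrict (Set.Icc 0 1)
      = Measure.pi fun _ : ι => (volume : Measure ℝ).restrict (Set.Icc 0 1) := by
  rw [← Set.pi_univ_Icc, volume_pi, Measure.restrict_pi_pi]
  rfl

lemma integrableOn_unitCube_prod {ι : Type*} [Fintype ι] {f : ι → ℝ → ℝ}
    (hf : ∀ j, IntegrableOn (f j) (Set.Icc 0 1)) :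
    IntegrableOn (fun u : ι → ℝ => ∏ j, f j (u j)) (Set.Icc 0 1) := by
  rw [IntegrableOn, volume_restrict_Icc_pi_eq_pi]
  exact Integrable.fintype_prod hf

lemma integral_unitCube_prod {ι : Type*} [Fintype ι] (f : ι → ℝ → ℝ) :
    ∫ u in Set.Icc (0 : ι → ℝ) 1, ∏ j, f j (u j) = ∏ j, ∫ x in Set.Icc (0 : ℝ) 1, f j x := by
  rw [volume_restrict_Icc_pi_eq_pi]
  exact integral_fintype_prod_eq_prod f

lemma integrableOn_Icc_ite_le_mul {g : ℝ → ℝ} (hg : Continuous g) (a : ℝ) :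
    IntegrableOn (fun x => (if a ≤ x then (1 : ℝ) else 0) * g x) (Set.Icc 0 1) := by
  have h : (fun x => (if a ≤ x then (1 : ℝ) else 0) * g x) = (Set.Ici a).indicator g := by
    ext x
    simp [Set.indicator_apply]
  rw [h]
  exact (hg.integrableOn_Icc).indicator measurableSet_Ici

lemma integral_Icc_ite_le_mul (g : ℝ → ℝ) {a : ℝ} (ha : a ∈ Set.Icc (0 : ℝ) 1) :
    ∫ x in Set.Icc (0 : ℝ) 1, (if a ≤ x then (1 : ℝ) else 0) * g x = ∫ x in a..1, g x := by
  have h : (fun x => (if a ≤ x then (1 : ℝ) else 0) * g x) = (Set.Ici a).indicator g := by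
    ext x
    simp [Set.indicator_apply]
  have hs : Set.Icc (0 : ℝ) 1 ∩ Set.Ici a = Set.Icc a 1 := by
    ext x
    simp only [Set.mem_inter_iff, Set.mem_Icc, Set.mem_Ici]
    exact ⟨fun hx => ⟨hx.2, hx.1.2⟩, fun hx => ⟨⟨ha.1.trans hx.1, hx.2⟩, hx.1⟩⟩
  rw [h, setIntegral_indicator measurableSet_Ici, hs, integral_Icc_eq_integral_Ioc,
    intervalIntegral.integral_of_le ha.2]

lemma integral_sub_half_sq (a : ℝ) :
    ∫ x in a..1, (x - 1 / 2) ^ 2 = 1 / 24 - 1 / 3 * (a - 1 / 2) ^ 3 := by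
  have h : ∀ x ∈ Set.uIcc a 1,
      HasDerivAt (fun y : ℝ => 1 / 3 * (y - 1 / 2) ^ 3) ((x - 1 / 2) ^ 2) x := fun x _ => by
    refine ((((hasDerivAt_id' x).sub_const (1 / 2)).pow 3).const_mul (1 / 3)).congr_deriv ?_
    norm_num
    ring
  rw [intervalIntegral.integral_eq_sub_of_hasDerivAt h
    (Continuous.intervalIntegrable (by fun_prop) _ _)]
  ring

lemma integral_mul_sub_half_sq (a : ℝ) :
    ∫ x in a..1, x * (x - 1 / 2) ^ 2
      = 1 / 24 - 1 / 4 * a ^ 4 + 1 / 3 * a ^ 3 - 1 / 8 * a ^ 2 := by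
  have h : ∀ x ∈ Set.uIcc a 1,
      HasDerivAt (fun y : ℝ => 1 / 4 * y ^ 4 - 1 / 3 * y ^ 3 + 1 / 8 * y ^ 2)
        (x * (x - 1 / 2) ^ 2) x := fun x _ => by
    refine ((((hasDerivAt_pow 4 x).const_mul (1 / 4)).sub
      ((hasDerivAt_pow 3 x).const_mul (1 / 3))).add
      ((hasDerivAt_pow 2 x).const_mul (1 / 8))).congr_deriv ?_
    norm_num
    ring
  rw [intervalIntegral.integral_eq_sub_of_hasDerivAt h
    (Continuous.intervalIntegrable (by fun_prop) _ _)]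
  ring

lemma integral_Icc_sq_mul_sub_half_sq :
    ∫ x in Set.Icc (0 : ℝ) 1, x ^ 2 * (x - 1 / 2) ^ 2 = (30 : ℝ)⁻¹ := by
  have h : ∀ x ∈ Set.uIcc (0 : ℝ) 1,
      HasDerivAt (fun y : ℝ => 1 / 5 * y ^ 5 - 1 / 4 * y ^ 4 + 1 / 12 * y ^ 3)
        (x ^ 2 * (x - 1 / 2) ^ 2) x := fun x _ => by
    refine ((((hasDerivAt_pow 5 x).const_mul (1 / 5)).sub
      ((hasDerivAt_pow 4 x).const_mul (1 / 4))).add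
      ((hasDerivAt_pow 3 x).const_mul (1 / 12))).congr_deriv ?_
    norm_num
    ring
  rw [integral_Icc_eq_integral_Ioc, ← intervalIntegral.integral_of_le zero_le_one,
    intervalIntegral.integral_eq_sub_of_hasDerivAt h
      (Continuous.intervalIntegrable (by fun_prop) _ _)]
  norm_num

/-- Expansion of the tail-weighted squared deviation into sums of coordinatewise products. -/
lemma tail_weighted_sq_expansion {n d : ℕ} (U : Fin n → Fin d → ℝ) (c : ℝ) (u : Fin d → ℝ) :
    (c * (∑ i, ∏ j, if U i j ≤ u j then (1 : ℝ) else 0) - ∏ j, u j) ^ 2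
        * ∏ j, (u j - 1 / 2) ^ 2
      = c ^ 2 * (∑ i, ∑ l, ∏ j,
            (if U i j ⊔ U l j ≤ u j then (1 : ℝ) else 0) * (u j - 1 / 2) ^ 2)
        - 2 * c * (∑ i, ∏ j, (if U i j ≤ u j then (1 : ℝ) else 0) * (u j * (u j - 1 / 2) ^ 2))
        + ∏ j, u j ^ 2 * (u j - 1 / 2) ^ 2 := by
  have hsup (i l : Fin n) (j : Fin d) : (if U i j ⊔ U l j ≤ u j then (1 : ℝ) else 0)
      = (if U i j ≤ u j then (1 : ℝ) else 0) * (if U l j ≤ u j then (1 : ℝ) else 0) := by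
    simp only [sup_le_iff, ite_and, ite_mul, one_mul, zero_mul]
  simp only [hsup, prod_mul_distrib, ← sum_mul, ← mul_sum, prod_pow]
  ring

/-- Closed form of the symmetric tail-weighted Cramér–von Mises statistic `Tₙ`
(weight `w(u) = ∏ⱼ (uⱼ − 1/2)²`). -/
theorem tail_weighted_cvm_closed_form
    (n d : ℕ) (hn : 1 ≤ n) (hd : 1 ≤ d)
    (U : Fin n → Fin d → ℝ) (hU : ∀ i j, U i j ∈ Set.Icc (0 : ℝ) 1)
    (Cn : (Fin d → ℝ) → ℝ)
    (hCn : ∀ u, Cn u =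
      (1 / n : ℝ) * ∑ i : Fin n, ∏ j : Fin d, if U i j ≤ u j then (1 : ℝ) else 0)
    (Tn : ℝ)
    (hTn : Tn = n * ∫ u in Set.Icc (0 : Fin d → ℝ) 1,
      (Cn u - ∏ j : Fin d, u j) ^ 2 * ∏ j : Fin d, (u j - 1 / 2) ^ 2) :
    Tn = (∑ i : Fin n,
        ((1 / n : ℝ) * ∑ l : Fin n,
            ∏ j : Fin d, ((1 / 24 : ℝ) - (1 / 3 : ℝ) * ((U i j ⊔ U l j) - 1 / 2) ^ 3)
          - 2 * ∏ j : Fin d,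
              ((1 / 24 : ℝ) - (1 / 4 : ℝ) * (U i j) ^ 4 + (1 / 3 : ℝ) * (U i j) ^ 3
                - (1 / 8 : ℝ) * (U i j) ^ 2)))
      + n * ((30 : ℝ) ^ d)⁻¹ := by
  have hi2 (i l : Fin n) : IntegrableOn (fun u : Fin d → ℝ => ∏ j,
      (if U i j ⊔ U l j ≤ u j then (1 : ℝ) else 0) * (u j - 1 / 2) ^ 2) (Set.Icc 0 1) :=
    integrableOn_unitCube_prod fun j =>
      integrableOn_Icc_ite_le_mul (g := fun x => (x - 1 / 2) ^ 2) (by fun_prop) _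
  have hi1 (i : Fin n) : IntegrableOn (fun u : Fin d → ℝ => ∏ j,
      (if U i j ≤ u j then (1 : ℝ) else 0) * (u j * (u j - 1 / 2) ^ 2)) (Set.Icc 0 1) :=
    integrableOn_unitCube_prod fun j =>
      integrableOn_Icc_ite_le_mul (g := fun x => x * (x - 1 / 2) ^ 2) (by fun_prop) _
  have hi0 : IntegrableOn (fun u : Fin d → ℝ => ∏ j, u j ^ 2 * (u j - 1 / 2) ^ 2)
      (Set.Icc 0 1) :=
    integrableOn_unitCube_prod (f := fun _ x => x ^ 2 * (x - 1 / 2) ^ 2) fun _ =>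
      Continuous.integrableOn_Icc (by fun_prop)
  have hv2 (i l : Fin n) : ∫ u in Set.Icc (0 : Fin d → ℝ) 1, ∏ j,
      (if U i j ⊔ U l j ≤ u j then (1 : ℝ) else 0) * (u j - 1 / 2) ^ 2
        = ∏ j, ((1 / 24 : ℝ) - (1 / 3 : ℝ) * ((U i j ⊔ U l j) - 1 / 2) ^ 3) := by
    rw [integral_unitCube_prod
      (fun j x => (if U i j ⊔ U l j ≤ x then (1 : ℝ) else 0) * (x - 1 / 2) ^ 2)]
    refine prod_congr rfl fun j _ => ?_
    rw [integral_Icc_ite_le_mul (fun x => (x - 1 / 2) ^ 2)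
      ⟨le_sup_of_le_left (hU i j).1, sup_le (hU i j).2 (hU l j).2⟩, integral_sub_half_sq]
  have hv1 (i : Fin n) : ∫ u in Set.Icc (0 : Fin d → ℝ) 1, ∏ j,
      (if U i j ≤ u j then (1 : ℝ) else 0) * (u j * (u j - 1 / 2) ^ 2)
        = ∏ j, ((1 / 24 : ℝ) - (1 / 4 : ℝ) * (U i j) ^ 4 + (1 / 3 : ℝ) * (U i j) ^ 3
                - (1 / 8 : ℝ) * (U i j) ^ 2) := by
    rw [integral_unitCube_prod
      (fun j x => (if U i j ≤ x then (1 : ℝ) else 0) * (x * (x - 1 / 2) ^ 2))]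
    refine prod_congr rfl fun j _ => ?_
    rw [integral_Icc_ite_le_mul (fun x => x * (x - 1 / 2) ^ 2) (hU i j),
      integral_mul_sub_half_sq]
  have hv0 : ∫ u in Set.Icc (0 : Fin d → ℝ) 1, ∏ j, u j ^ 2 * (u j - 1 / 2) ^ 2
      = ((30 : ℝ) ^ d)⁻¹ := by
    rw [integral_unitCube_prod (fun _ x => x ^ 2 * (x - 1 / 2) ^ 2),
      integral_Icc_sq_mul_sub_half_sq, prod_const, card_univ, Fintype.card_fin, inv_pow]
  have hn0 : (n : ℝ) ≠ 0 := Nat.cast_ne_zero.mpr (by omega)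
  have hs2 := integrable_finsetSum univ fun i _ => integrable_finsetSum univ fun l _ => hi2 i l
  have hs1 := integrable_finsetSum univ fun i _ => hi1 i
  simp only [hTn, hCn, tail_weighted_sq_expansion]
  rw [integral_add ((hs2.const_mul _).sub' (hs1.const_mul _)) hi0,
    integral_sub (hs2.const_mul _) (hs1.const_mul _), integral_const_mul, integral_const_mul,
    integral_finsetSum _ fun i _ => integrable_finsetSum univ fun l _ => hi2 i l,
    integral_finsetSum _ fun i _ => hi1 i, hv0]
  simp only [integral_finsetSum univ fun l _ => hi2 _ l, hv2, hv1, sum_sub_distrib, ← mul_sum]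
  generalize (∑ i : Fin n, ∑ l : Fin n, ∏ j : Fin d,
    ((1 / 24 : ℝ) - (1 / 3 : ℝ) * ((U i j ⊔ U l j) - 1 / 2) ^ 3)) = A
  generalize (∑ i : Fin n, ∏ j : Fin d, ((1 / 24 : ℝ) - (1 / 4 : ℝ) * (U i j) ^ 4
    + (1 / 3 : ℝ) * (U i j) ^ 3 - (1 / 8 : ℝ) * (U i j) ^ 2)) = B
  field_simp
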